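/- Define W(x) = √3 · [ (1 + √(1 − 4x²/27))^{1/3} − (1 − √(1 − 4x²/27))^{1/3} ] / (2^{4/3}·π·x^{1/3}) + √3 · x^{1/3} · [ (1 + √(1 − 4x²/27))^{2/3} − (1 − √(1 − 4x²/27))^{2/3} ] / (2^{5/3}·π) for x ∈ (0, 3√3/2). Then W(x) ≥ 0 on (0, 3√3/2) and for every natural number m, ∫₀^{3√3/2} x^m · W(x) dx = A_m(3/2, 1) = Γ(3m/2 + 1) / (m!·Γ(m/2 + 2)). -/

import Mathlib

open Real

/-- The Raney numbers (two-parameter Fuss–Catalan numbers):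
`A 0 (p,r) = 1` and `A m (p,r) = (r/m!)·∏_{i=1}^{m−1} (m·p + r − i)` for `m ≥ 1`. -/
noncomputable def raney (p r : ℝ) : ℕ → ℝ
  | 0 => 1
  | (m + 1) => (r / (Nat.factorial (m + 1) : ℝ)) *
      ∏ i ∈ Finset.Icc 1 m, (((m : ℝ) + 1) * p + r - (i : ℝ))

/-- Euler's beta integral over the reals. -/
theorem intervalIntegrable_and_integral_rpow_mul_one_sub_rpow {a b : ℝ} (ha : 0 < a)
    (hb : 0 < b) :
    IntervalIntegrable (fun t : ℝ => t ^ (a - 1) * (1 - t) ^ (b - 1)) MeasureTheory.volume 0 1 ∧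
      ∫ t in (0 : ℝ)..1, t ^ (a - 1) * (1 - t) ^ (b - 1) = Gamma a * Gamma b / Gamma (a + b) := by
  have hcast : ∀ t ∈ Set.uIcc (0 : ℝ) 1,
      (t : ℂ) ^ ((a : ℂ) - 1) * (1 - (t : ℂ)) ^ ((b : ℂ) - 1) =
        ((t ^ (a - 1) * (1 - t) ^ (b - 1) : ℝ) : ℂ) := by
    intro t ht
    rw [Set.uIcc_of_le zero_le_one] at ht
    rw [Complex.ofReal_mul, Complex.ofReal_cpow ht.1, Complex.ofReal_cpow (sub_nonneg.2 ht.2)]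
    push_cast
    rfl
  have hint := Complex.betaIntegral_convergent (u := a) (v := b) (by simpa) (by simpa)
  have hint' : IntervalIntegrable
      (fun t : ℝ => ((t ^ (a - 1) * (1 - t) ^ (b - 1) : ℝ) : ℂ)) MeasureTheory.volume 0 1 :=
    hint.congr fun t ht => hcast t (Set.uIoc_subset_uIcc ht)
  refine ⟨?_, ?_⟩
  · rw [intervalIntegrable_iff] at hint' ⊢
    exact hint'.re
  · have h := ProbabilityTheory.beta_eq_betaIntegralReal a b ha hb
    rw [Complex.betaIntegral, intervalIntegral.integral_congr hcast,
      intervalIntegral.integral_ofReal, Complex.ofReal_re] at h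
    exact h.symm

/-- Gauss's multiplication formula for the factor `3`, at half-integers. -/
theorem Gamma_half_nat_add_third_mul_Gamma_half_nat_add_two_thirds (m : ℕ) :
    Gamma ((m : ℝ) / 2 + 1 / 3) * Gamma ((m : ℝ) / 2 + 2 / 3) * Gamma ((m : ℝ) / 2 + 1) *
      (3 * √3) ^ (m + 1) = 6 * π * Gamma (3 * (m : ℝ) / 2 + 1) := by
  have h3 : √3 * √3 = 3 := mul_self_sqrt (by norm_num)
  have hpi := pi_pos
  induction m using Nat.twoStepInduction with
  | zero =>
    have h := Gamma_mul_Gamma_one_sub (1 / 3)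
    rw [show π * (1 / 3) = π / 3 by ring, sin_pi_div_three] at h
    norm_num at h ⊢
    rw [h]
    field_simp
    norm_num
  | one =>
    have h := Gamma_mul_Gamma_one_sub (1 / 6)
    rw [show π * (1 / 6) = π / 6 by ring, sin_pi_div_six] at h
    have h7 := Gamma_add_one (s := 1 / 6) (by norm_num)
    have h5 := Gamma_add_one (s := 3 / 2) (by norm_num)
    norm_num at h h7 h5 ⊢
    rw [h7, h5]
    linear_combination (27 / 6 * Gamma (3 / 2)) * h +
      (9 * (Gamma (5 / 6) * (1 / 6 * Gamma (1 / 6)) * Gamma (3 / 2))) * h3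
  | more n ih _ =>
    have hn : (0 : ℝ) ≤ n := n.cast_nonneg
    have h1 := Gamma_add_one (s := (n : ℝ) / 2 + 1 / 3) (by positivity)
    have h2 := Gamma_add_one (s := (n : ℝ) / 2 + 2 / 3) (by positivity)
    have h4 := Gamma_add_one (s := (n : ℝ) / 2 + 1) (by positivity)
    have h5 := Gamma_add_one (s := 3 * (n : ℝ) / 2 + 1) (by positivity)
    have h6 := Gamma_add_one (s := 3 * (n : ℝ) / 2 + 1 + 1) (by positivity)
    have h7 := Gamma_add_one (s := 3 * (n : ℝ) / 2 + 1 + 1 + 1) (by positivity)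
    push_cast
    rw [show ((n : ℝ) + 2) / 2 + 1 / 3 = (n : ℝ) / 2 + 1 / 3 + 1 by ring,
      show ((n : ℝ) + 2) / 2 + 2 / 3 = (n : ℝ) / 2 + 2 / 3 + 1 by ring,
      show ((n : ℝ) + 2) / 2 + 1 = (n : ℝ) / 2 + 1 + 1 by ring,
      show 3 * ((n : ℝ) + 2) / 2 + 1 = 3 * (n : ℝ) / 2 + 1 + 1 + 1 + 1 by ring,
      h1, h2, h4, h7, h6, h5,
      show (3 * √3) ^ (n + 2 + 1) = (3 * √3) ^ (n + 1) * (9 * (√3 * √3)) by ring, h3]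
    linear_combination
      (27 * (n / 2 + 1 / 3) * (n / 2 + 2 / 3) * (n / 2 + 1) : ℝ) * ih

theorem Gamma_add_nat_eq_prod_mul {s : ℝ} (hs : 0 < s) (m : ℕ) :
    Gamma (s + m) = (∏ i ∈ Finset.Icc 1 m, (s + m - i)) * Gamma s := by
  induction m generalizing s with
  | zero => simp
  | succ m ih =>
    have h := ih (s := s + 1) (by positivity)
    rw [Finset.prod_Icc_succ_top (by omega)]
    push_cast
    rw [show s + ((m : ℝ) + 1) = s + 1 + m by ring, h, Gamma_add_one hs.ne']
    ring

theorem raney_three_halves_one_eq (m : ℕ) :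
    raney (3 / 2) 1 m =
      Gamma (3 * (m : ℝ) / 2 + 1) / ((Nat.factorial m : ℝ) * Gamma ((m : ℝ) / 2 + 2)) := by
  cases m with
  | zero => norm_num [raney]
  | succ m =>
    have hpos : (0 : ℝ) < ((m : ℝ) + 1) / 2 + 2 := by positivity
    have h := Gamma_add_nat_eq_prod_mul hpos m
    have hG := (Gamma_pos_of_pos hpos).ne'
    rw [raney]
    push_cast
    rw [show 3 * ((m : ℝ) + 1) / 2 + 1 = ((m : ℝ) + 1) / 2 + 2 + m by ring, h,
      show ((m : ℝ) + 1) * (3 / 2) + 1 = ((m : ℝ) + 1) / 2 + 2 + m by ring]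
    field_simp

/-- The density with moments `raney (3 / 2) 1 m`. -/
noncomputable def raneyDensity (x : ℝ) : ℝ :=
  √3 * ((1 + √(1 - 4 * x ^ 2 / 27)) ^ ((1 : ℝ) / 3) -
      (1 - √(1 - 4 * x ^ 2 / 27)) ^ ((1 : ℝ) / 3)) /
    ((2 : ℝ) ^ ((4 : ℝ) / 3) * π * x ^ ((1 : ℝ) / 3)) +
  √3 * x ^ ((1 : ℝ) / 3) * ((1 + √(1 - 4 * x ^ 2 / 27)) ^ ((2 : ℝ) / 3) -
      (1 - √(1 - 4 * x ^ 2 / 27)) ^ ((2 : ℝ) / 3)) /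
    ((2 : ℝ) ^ ((5 : ℝ) / 3) * π)

theorem raneyDensity_nonneg {x : ℝ} (hx : 0 ≤ x) : 0 ≤ raneyDensity x := by
  have hs : √(1 - 4 * x ^ 2 / 27) ≤ 1 := sqrt_le_one.2 (by linarith [sq_nonneg x])
  have hs0 := sqrt_nonneg (1 - 4 * x ^ 2 / 27)
  have h : ∀ q : ℝ, 0 ≤ q → 0 ≤ (1 + √(1 - 4 * x ^ 2 / 27)) ^ q -
      (1 - √(1 - 4 * x ^ 2 / 27)) ^ q := fun q hq =>
    sub_nonneg.2 (rpow_le_rpow (by linarith) (by linarith) hq)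
  have h1 := h (1 / 3) (by norm_num)
  have h2 := h (2 / 3) (by norm_num)
  have hpi := pi_pos
  unfold raneyDensity
  positivity

/-- In terms of `T = t ^ (1 / 6)` and `P = (1 - t) ^ (1 / 6)`, the density at
`3 √3 √(t (1 - t))` is a rational function. -/
theorem raneyDensity_three_mul_sqrt_three_mul {T P : ℝ} (hT : 0 < T) (hP : 0 < P)
    (hTP : T ^ 6 + P ^ 6 = 1) (hle : T ^ 6 ≤ P ^ 6) :
    raneyDensity (3 * √3 * (T * P) ^ 3) =
      1 / (2 * π) * ((P ^ 2 - T ^ 2) / (T * P) + 3 * (T * P) * (P ^ 4 - T ^ 4)) := by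
  have h3 : √3 ^ 2 = 3 := sq_sqrt (by norm_num)
  have h3p : 0 < √3 := by positivity
  have hroot : ∀ y : ℝ, 0 ≤ y → ∀ n : ℕ, (y ^ 3) ^ ((n : ℝ) / 3) = y ^ n := by
    intro y hy n
    rw [← rpow_natCast y 3, ← rpow_mul hy, ← rpow_natCast y n]
    congr 1
    push_cast
    ring
  have hs : √(1 - 4 * (3 * √3 * (T * P) ^ 3) ^ 2 / 27) = P ^ 6 - T ^ 6 := by
    rw [show 1 - 4 * (3 * √3 * (T * P) ^ 3) ^ 2 / 27 = (P ^ 6 - T ^ 6) ^ 2 by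
      linear_combination (-(4 / 3) * (T * P) ^ 6) * h3 - (T ^ 6 + P ^ 6 + 1) * hTP]
    exact sqrt_sq (by linarith)
  have hx : (3 * √3 * (T * P) ^ 3) ^ ((1 : ℝ) / 3) = √3 * (T * P) := by
    have := hroot (√3 * (T * P)) (by positivity) 1
    rw [Nat.cast_one, pow_one] at this
    rw [← this]
    congr 1
    linear_combination (-√3 * (T * P) ^ 3) * h3
  have h1P : (2 * P ^ 6) ^ ((1 : ℝ) / 3) = 2 ^ ((1 : ℝ) / 3) * P ^ 2 := by
    have := hroot (P ^ 2) (by positivity) 1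
    rw [mul_rpow (by norm_num) (by positivity), show P ^ 6 = (P ^ 2) ^ 3 by ring]
    simpa using this
  have h1T : (2 * T ^ 6) ^ ((1 : ℝ) / 3) = 2 ^ ((1 : ℝ) / 3) * T ^ 2 := by
    have := hroot (T ^ 2) (by positivity) 1
    rw [mul_rpow (by norm_num) (by positivity), show T ^ 6 = (T ^ 2) ^ 3 by ring]
    simpa using this
  have h2P : (2 * P ^ 6) ^ ((2 : ℝ) / 3) = 2 ^ ((2 : ℝ) / 3) * P ^ 4 := by
    have := hroot (P ^ 2) (by positivity) 2
    rw [mul_rpow (by norm_num) (by positivity), show P ^ 6 = (P ^ 2) ^ 3 by ring]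
    rw [show P ^ 4 = (P ^ 2) ^ 2 by ring, ← this]
    norm_num
  have h2T : (2 * T ^ 6) ^ ((2 : ℝ) / 3) = 2 ^ ((2 : ℝ) / 3) * T ^ 4 := by
    have := hroot (T ^ 2) (by positivity) 2
    rw [mul_rpow (by norm_num) (by positivity), show T ^ 6 = (T ^ 2) ^ 3 by ring]
    rw [show T ^ 4 = (T ^ 2) ^ 2 by ring, ← this]
    norm_num
  have h43 : (2 : ℝ) ^ ((4 : ℝ) / 3) = 2 * 2 ^ ((1 : ℝ) / 3) := by
    rw [show (4 : ℝ) / 3 = 1 + 1 / 3 by norm_num, rpow_add (by norm_num), rpow_one]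
  have h53 : (2 : ℝ) ^ ((5 : ℝ) / 3) = 2 * 2 ^ ((2 : ℝ) / 3) := by
    rw [show (5 : ℝ) / 3 = 1 + 2 / 3 by norm_num, rpow_add (by norm_num), rpow_one]
  have hc1 : (0 : ℝ) < 2 ^ ((1 : ℝ) / 3) := by positivity
  have hc2 : (0 : ℝ) < 2 ^ ((2 : ℝ) / 3) := by positivity
  have hpi := pi_pos
  rw [raneyDensity, hs, hx, show 1 + (P ^ 6 - T ^ 6) = 2 * P ^ 6 by linear_combination -hTP,
    show 1 - (P ^ 6 - T ^ 6) = 2 * T ^ 6 by linear_combination -hTP, h1P, h1T, h2P, h2T, h43, h53]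
  generalize (2 : ℝ) ^ ((1 : ℝ) / 3) = c at *
  generalize (2 : ℝ) ^ ((2 : ℝ) / 3) = d at *
  field_simp
  rw [h3]
  ring

theorem image_three_mul_sqrt_three_mul_sqrt :
    (fun t : ℝ => 3 * √3 * √(t * (1 - t))) '' Set.Ioo 0 (1 / 2) =
      Set.Ioo 0 (3 * √3 / 2) := by
  have h3 : √3 ^ 2 = 3 := sq_sqrt (by norm_num)
  have h3p : 0 < √3 := by positivity
  ext x
  constructor
  · rintro ⟨t, ⟨ht0, ht1⟩, rfl⟩
    have hpos : 0 < t * (1 - t) := mul_pos ht0 (by linarith)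
    refine ⟨by positivity, ?_⟩
    have : √(t * (1 - t)) < 1 / 2 := by
      rw [sqrt_lt' (by norm_num)]
      nlinarith [sq_pos_of_pos (sub_pos.2 ht1)]
    show 3 * √3 * √(t * (1 - t)) < _
    nlinarith
  · rintro ⟨hx0, hx1⟩
    have hx2 : x ^ 2 < 27 / 4 := by nlinarith
    have hs0 : 0 < √(1 - 4 * x ^ 2 / 27) := sqrt_pos.2 (by linarith)
    have hs2 : √(1 - 4 * x ^ 2 / 27) ^ 2 = 1 - 4 * x ^ 2 / 27 := sq_sqrt (by linarith)
    have hs1 : √(1 - 4 * x ^ 2 / 27) < 1 := by nlinarith [sq_pos_of_pos hx0]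
    generalize √(1 - 4 * x ^ 2 / 27) = s at *
    refine ⟨(1 - s) / 2, ⟨by linarith, by linarith⟩, ?_⟩
    have : √((1 - s) / 2 * (1 - (1 - s) / 2)) = x / (3 * √3) := by
      rw [show (1 - s) / 2 * (1 - (1 - s) / 2) = (x / (3 * √3)) ^ 2 by
        rw [div_pow, mul_pow, h3]
        linear_combination (-1 / 4) * hs2]
      exact sqrt_sq (by positivity)
    show 3 * √3 * √((1 - s) / 2 * (1 - (1 - s) / 2)) = x
    rw [this]
    field_simp

theorem injOn_three_mul_sqrt_three_mul_sqrt :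
    Set.InjOn (fun t : ℝ => 3 * √3 * √(t * (1 - t))) (Set.Ioo 0 (1 / 2)) := by
  rintro a ⟨ha0, ha1⟩ b ⟨hb0, hb1⟩ hab
  have h3p : 0 < √3 := by positivity
  have h := mul_left_cancel₀ (by positivity) hab
  rw [sqrt_inj (mul_nonneg ha0.le (by linarith)) (mul_nonneg hb0.le (by linarith))] at h
  have h' : (a - b) * (1 - a - b) = 0 := by linear_combination h
  rcases mul_eq_zero.1 h' with h' | h' <;> linarith

theorem hasDerivAt_three_mul_sqrt_three_mul_sqrt {t : ℝ} (ht : t ∈ Set.Ioo (0 : ℝ) (1 / 2)) :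
    HasDerivAt (fun t : ℝ => 3 * √3 * √(t * (1 - t)))
      (3 * √3 * ((1 - 2 * t) / (2 * √(t * (1 - t))))) t := by
  have hpos : 0 < t * (1 - t) := mul_pos ht.1 (by linarith [ht.2])
  have hmul : HasDerivAt (fun t : ℝ => t * (1 - t)) (1 - 2 * t) t :=
    ((hasDerivAt_id' t).mul ((hasDerivAt_id' t).const_sub 1)).congr_deriv (by ring)
  exact (hmul.sqrt hpos.ne').const_mul _

/-- A combination of beta integrands whose symmetrization is the pullback of
`x ^ m * raneyDensity x` under `x = 3 √3 √(t (1 - t))`. -/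
noncomputable def raneyBetaIntegrand (m : ℕ) (t : ℝ) : ℝ :=
  (3 * √3) ^ (m + 1) / (4 * π) *
    (t ^ ((m : ℝ) / 2 + 1 / 3 - 1) * (1 - t) ^ ((m : ℝ) / 2 + 5 / 3 - 1) -
      t ^ ((m : ℝ) / 2 + 4 / 3 - 1) * (1 - t) ^ ((m : ℝ) / 2 + 2 / 3 - 1) +
      3 * (t ^ ((m : ℝ) / 2 + 2 / 3 - 1) * (1 - t) ^ ((m : ℝ) / 2 + 7 / 3 - 1)) -
      3 * (t ^ ((m : ℝ) / 2 + 5 / 3 - 1) * (1 - t) ^ ((m : ℝ) / 2 + 4 / 3 - 1)))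

theorem intervalIntegrable_raneyBetaIntegrand (m : ℕ) :
    IntervalIntegrable (raneyBetaIntegrand m) MeasureTheory.volume 0 1 := by
  have h := fun (a b : ℝ) (ha : 0 < a) (hb : 0 < b) =>
    (intervalIntegrable_and_integral_rpow_mul_one_sub_rpow ha hb).1
  exact ((((h _ _ (by positivity) (by positivity)).sub
    (h _ _ (by positivity) (by positivity))).add
    ((h _ _ (by positivity) (by positivity)).const_mul 3)).sub
    ((h _ _ (by positivity) (by positivity)).const_mul 3)).const_mul _

theorem integral_raneyBetaIntegrand (m : ℕ) :
    ∫ t in (0 : ℝ)..1, raneyBetaIntegrand m t = raney (3 / 2) 1 m := by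
  have h := fun (a b : ℝ) (ha : 0 < a) (hb : 0 < b) =>
    intervalIntegrable_and_integral_rpow_mul_one_sub_rpow ha hb
  have hA := h ((m : ℝ) / 2 + 1 / 3) ((m : ℝ) / 2 + 5 / 3) (by positivity) (by positivity)
  have hB := h ((m : ℝ) / 2 + 4 / 3) ((m : ℝ) / 2 + 2 / 3) (by positivity) (by positivity)
  have hC := h ((m : ℝ) / 2 + 2 / 3) ((m : ℝ) / 2 + 7 / 3) (by positivity) (by positivity)
  have hD := h ((m : ℝ) / 2 + 5 / 3) ((m : ℝ) / 2 + 4 / 3) (by positivity) (by positivity)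
  have hG := Gamma_half_nat_add_third_mul_Gamma_half_nat_add_two_thirds m
  have h1 := Gamma_add_one (s := (m : ℝ) / 2 + 1 / 3) (by positivity)
  have h2 := Gamma_add_one (s := (m : ℝ) / 2 + 2 / 3) (by positivity)
  have h3 := Gamma_add_one (s := (m : ℝ) / 2 + 1 / 3 + 1) (by positivity)
  have h4 := Gamma_add_one (s := (m : ℝ) / 2 + 1) (by positivity)
  have h5 := Gamma_nat_eq_factorial m
  have h6 := Gamma_add_one (s := (m : ℝ) + 1) (by positivity)
  have h7 := Gamma_add_one (s := (m : ℝ) + 1 + 1) (by positivity)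
  have hpos := Gamma_pos_of_pos (s := (m : ℝ) / 2 + 1) (by positivity)
  have hfac : (0 : ℝ) < Nat.factorial m := by positivity
  have hpi := pi_pos
  have e43 : (m : ℝ) / 2 + 4 / 3 = (m : ℝ) / 2 + 1 / 3 + 1 := by ring
  have e53 : (m : ℝ) / 2 + 5 / 3 = (m : ℝ) / 2 + 2 / 3 + 1 := by ring
  have e73 : (m : ℝ) / 2 + 7 / 3 = (m : ℝ) / 2 + 1 / 3 + 1 + 1 := by ring
  simp only [raneyBetaIntegrand]
  rw [intervalIntegral.integral_const_mul,
    intervalIntegral.integral_sub ((hA.1.sub hB.1).add (hC.1.const_mul 3)) (hD.1.const_mul 3),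
    intervalIntegral.integral_add (hA.1.sub hB.1) (hC.1.const_mul 3),
    intervalIntegral.integral_sub hA.1 hB.1, intervalIntegral.integral_const_mul,
    intervalIntegral.integral_const_mul, hA.2, hB.2, hC.2, hD.2, raney_three_halves_one_eq,
    show (m : ℝ) / 2 + 1 / 3 + ((m : ℝ) / 2 + 5 / 3) = m + 1 + 1 by ring,
    show (m : ℝ) / 2 + 4 / 3 + ((m : ℝ) / 2 + 2 / 3) = m + 1 + 1 by ring,
    show (m : ℝ) / 2 + 2 / 3 + ((m : ℝ) / 2 + 7 / 3) = m + 1 + 1 + 1 by ring,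
    show (m : ℝ) / 2 + 5 / 3 + ((m : ℝ) / 2 + 4 / 3) = m + 1 + 1 + 1 by ring,
    e43, e53, e73, show (m : ℝ) / 2 + 2 = (m : ℝ) / 2 + 1 + 1 by ring,
    h7, h6, h5, h4, h3, h2, h1]
  generalize Gamma ((m : ℝ) / 2 + 1 / 3) = G1 at *
  generalize Gamma ((m : ℝ) / 2 + 2 / 3) = G2 at *
  generalize Gamma ((m : ℝ) / 2 + 1) = G3 at *
  generalize (3 * √3) ^ (m + 1) = K at *
  have hR : Gamma (3 * (m : ℝ) / 2 + 1) = G1 * G2 * G3 * K / (6 * π) := by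
    rw [hG, mul_div_cancel_left₀ _ (by positivity)]
  rw [hR]
  field_simp
  ring

theorem jacobian_mul_pow_mul_raneyDensity (m : ℕ) {t : ℝ} (ht : t ∈ Set.Ioo (0 : ℝ) (1 / 2)) :
    |3 * √3 * ((1 - 2 * t) / (2 * √(t * (1 - t))))| •
      ((3 * √3 * √(t * (1 - t))) ^ m * raneyDensity (3 * √3 * √(t * (1 - t)))) =
      raneyBetaIntegrand m t + raneyBetaIntegrand m (1 - t) := by
  obtain ⟨ht0, ht1⟩ := ht
  have hp0 : 0 < 1 - t := by linarith
  have hpow : ∀ y : ℝ, 0 < y → ∀ k : ℤ,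
      y ^ ((m : ℝ) / 2 + k / 6) = (y ^ ((1 : ℝ) / 6)) ^ (3 * m) * (y ^ ((1 : ℝ) / 6)) ^ k := by
    intro y hy k
    rw [← rpow_natCast, ← rpow_intCast, ← rpow_mul hy.le, ← rpow_mul hy.le, ← rpow_add hy]
    congr 1
    push_cast
    ring
  have hsix : ∀ y : ℝ, 0 < y → (y ^ ((1 : ℝ) / 6)) ^ 6 = y := by
    intro y hy
    rw [← rpow_natCast, ← rpow_mul hy.le]
    norm_num
  have e13 : (m : ℝ) / 2 + 1 / 3 - 1 = m / 2 + ((-4 : ℤ) : ℝ) / 6 := by push_cast; ring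
  have e23 : (m : ℝ) / 2 + 2 / 3 - 1 = m / 2 + ((-2 : ℤ) : ℝ) / 6 := by push_cast; ring
  have e43 : (m : ℝ) / 2 + 4 / 3 - 1 = m / 2 + ((2 : ℤ) : ℝ) / 6 := by push_cast; ring
  have e53 : (m : ℝ) / 2 + 5 / 3 - 1 = m / 2 + ((4 : ℤ) : ℝ) / 6 := by push_cast; ring
  have e73 : (m : ℝ) / 2 + 7 / 3 - 1 = m / 2 + ((8 : ℤ) : ℝ) / 6 := by push_cast; ring
  have hT6 := hsix t ht0
  have hP6 := hsix (1 - t) hp0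
  have hT : 0 < t ^ ((1 : ℝ) / 6) := by positivity
  have hP : 0 < (1 - t) ^ ((1 : ℝ) / 6) := by positivity
  simp only [raneyBetaIntegrand, sub_sub_cancel, e13, e23, e43, e53, e73, hpow t ht0,
    hpow (1 - t) hp0]
  generalize t ^ ((1 : ℝ) / 6) = T at *
  generalize (1 - t) ^ ((1 : ℝ) / 6) = P at *
  have hsqrt : √(t * (1 - t)) = (T * P) ^ 3 := by
    rw [← hP6, ← hT6, show T ^ 6 * P ^ 6 = ((T * P) ^ 3) ^ 2 by ring]
    exact sqrt_sq (by positivity)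
  have hpi := pi_pos
  have h3p : 0 < √3 := by positivity
  have hle : 0 < 1 - 2 * t := by linarith
  rw [hsqrt, raneyDensity_three_mul_sqrt_three_mul hT hP (by linarith) (by linarith),
    abs_of_pos (by positivity), smul_eq_mul,
    show 1 - 2 * t = P ^ 6 - T ^ 6 by linarith]
  simp only [zpow_neg, zpow_ofNat, mul_pow, pow_mul, pow_succ (3 * √3) m]
  field_simp
  ring

theorem integral_pow_mul_raneyDensity (m : ℕ) :
    ∫ x in (0 : ℝ)..(3 * √3 / 2), x ^ m * raneyDensity x = raney (3 / 2) 1 m := by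
  have h0 : (0 : ℝ) ≤ 3 * √3 / 2 := by positivity
  have hint := intervalIntegrable_raneyBetaIntegrand m
  have hint1 : IntervalIntegrable (raneyBetaIntegrand m) MeasureTheory.volume 0 (1 / 2) :=
    hint.mono_set (by
      rw [Set.uIcc_of_le (by norm_num), Set.uIcc_of_le (by norm_num)]
      exact Set.Icc_subset_Icc le_rfl (by norm_num))
  have hint2 : IntervalIntegrable (raneyBetaIntegrand m) MeasureTheory.volume (1 / 2) 1 :=
    hint.mono_set (by
      rw [Set.uIcc_of_le (by norm_num), Set.uIcc_of_le (by norm_num)]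
      exact Set.Icc_subset_Icc (by norm_num) le_rfl)
  have hint3 : IntervalIntegrable (fun t => raneyBetaIntegrand m (1 - t))
      MeasureTheory.volume 0 (1 / 2) := by
    have := (hint2.comp_sub_left 1).symm
    norm_num at this ⊢
    exact this
  rw [intervalIntegral.integral_of_le h0, MeasureTheory.integral_Ioc_eq_integral_Ioo,
    ← image_three_mul_sqrt_three_mul_sqrt,
    MeasureTheory.integral_image_eq_integral_abs_deriv_smul measurableSet_Ioo
      (fun t ht => (hasDerivAt_three_mul_sqrt_three_mul_sqrt ht).hasDerivWithinAt)
      injOn_three_mul_sqrt_three_mul_sqrt,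
    MeasureTheory.setIntegral_congr_fun measurableSet_Ioo
      (fun t ht => jacobian_mul_pow_mul_raneyDensity m ht),
    ← MeasureTheory.integral_Ioc_eq_integral_Ioo,
    ← intervalIntegral.integral_of_le (by norm_num),
    intervalIntegral.integral_add hint1 hint3, intervalIntegral.integral_comp_sub_left,
    show (1 : ℝ) - 1 / 2 = 1 / 2 by norm_num, sub_zero,
    intervalIntegral.integral_add_adjacent_intervals hint1 hint2, integral_raneyBetaIntegrand]

/-- For
`W(x) = √3·[(1 + √(1 − 4x²/27))^(1/3) − (1 − √(1 − 4x²/27))^(1/3)]/(2^(4/3)·π·x^(1/3))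
      + √3·x^(1/3)·[(1 + √(1 − 4x²/27))^(2/3) − (1 − √(1 − 4x²/27))^(2/3)]/(2^(5/3)·π)`
on `(0, 3√3/2)`: `W ≥ 0` there, and
`∫₀^{3√3/2} x^m·W(x) dx = A_m(3/2, 1) = Γ(3m/2 + 1)/(m!·Γ(m/2 + 2))`. -/
theorem stmt_13 :
    (∀ x ∈ Set.Ioo (0 : ℝ) (3 * Real.sqrt 3 / 2),
      0 ≤ Real.sqrt 3 *
          ((1 + Real.sqrt (1 - 4 * x ^ 2 / 27)) ^ ((1 : ℝ) / 3) -
            (1 - Real.sqrt (1 - 4 * x ^ 2 / 27)) ^ ((1 : ℝ) / 3)) /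
          ((2 : ℝ) ^ ((4 : ℝ) / 3) * π * x ^ ((1 : ℝ) / 3)) +
        Real.sqrt 3 * x ^ ((1 : ℝ) / 3) *
          ((1 + Real.sqrt (1 - 4 * x ^ 2 / 27)) ^ ((2 : ℝ) / 3) -
            (1 - Real.sqrt (1 - 4 * x ^ 2 / 27)) ^ ((2 : ℝ) / 3)) /
          ((2 : ℝ) ^ ((5 : ℝ) / 3) * π)) ∧
    ∀ m : ℕ,
      (∫ x in (0:ℝ)..(3 * Real.sqrt 3 / 2),
        x ^ m * (Real.sqrt 3 *
            ((1 + Real.sqrt (1 - 4 * x ^ 2 / 27)) ^ ((1 : ℝ) / 3) -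
              (1 - Real.sqrt (1 - 4 * x ^ 2 / 27)) ^ ((1 : ℝ) / 3)) /
            ((2 : ℝ) ^ ((4 : ℝ) / 3) * π * x ^ ((1 : ℝ) / 3)) +
          Real.sqrt 3 * x ^ ((1 : ℝ) / 3) *
            ((1 + Real.sqrt (1 - 4 * x ^ 2 / 27)) ^ ((2 : ℝ) / 3) -
              (1 - Real.sqrt (1 - 4 * x ^ 2 / 27)) ^ ((2 : ℝ) / 3)) /
            ((2 : ℝ) ^ ((5 : ℝ) / 3) * π)))
      = raney (3 / 2) 1 m ∧
      raney (3 / 2) 1 m =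
        Gamma (3 * (m : ℝ) / 2 + 1) /
          ((Nat.factorial m : ℝ) * Gamma ((m : ℝ) / 2 + 2)) := by
  exact ⟨fun x hx => raneyDensity_nonneg hx.1.le, fun m =>
    ⟨integral_pow_mul_raneyDensity m, raney_three_halves_one_eq m⟩⟩
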